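/- The lowered conjugate Pauli matrices are independent of the sign choice: for all I ∈ {0,1,2,3} and α,β ∈ {1,2}, Σ_N G_{+IN} σ̄_+^{Nα̇β} = Σ_N G_{−IN} σ̄_−^{Nα̇β}. -/

import Mathlib

noncomputable section

open scoped Matrix

/-- Lower undotted spinor metric `ε_{αβ}` of the two-parameter deformation. -/
def epsLo (q r : ℝ) : Matrix (Fin 2) (Fin 2) ℂ :=
  ((Real.sqrt (1 - r ^ 2) : ℂ))⁻¹ •
    !![Complex.I * (r : ℂ), -((Real.sqrt q : ℂ))⁻¹; (Real.sqrt q : ℂ), Complex.I * (r : ℂ)]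

/-- Upper undotted spinor metric `ε^{αβ}`. -/
def epsUp (q r : ℝ) : Matrix (Fin 2) (Fin 2) ℂ :=
  ((Real.sqrt (1 - r ^ 2) : ℂ))⁻¹ •
    !![Complex.I * (r : ℂ), ((Real.sqrt q : ℂ))⁻¹; -(Real.sqrt q : ℂ), Complex.I * (r : ℂ)]

/-- Lower dotted spinor metric `ε_{α̇β̇}`. -/
def epsLoD (q r : ℝ) : Matrix (Fin 2) (Fin 2) ℂ :=
  ((Real.sqrt (1 - r ^ 2) : ℂ))⁻¹ •
    !![-(Complex.I * (r : ℂ)), (Real.sqrt q : ℂ); -((Real.sqrt q : ℂ))⁻¹, -(Complex.I * (r : ℂ))]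

/-- Upper dotted spinor metric `ε^{α̇β̇}`. -/
def epsUpD (q r : ℝ) : Matrix (Fin 2) (Fin 2) ℂ :=
  ((Real.sqrt (1 - r ^ 2) : ℂ))⁻¹ •
    !![-(Complex.I * (r : ℂ)), -(Real.sqrt q : ℂ); ((Real.sqrt q : ℂ))⁻¹, -(Complex.I * (r : ℂ))]

/-- `Q = (2r + q + q⁻¹)/(1 − r²)`. -/
def Qval (q r : ℝ) : ℝ := (2 * r + q + q⁻¹) / (1 - r ^ 2)

/-- The R-matrix `R^{αβ}_{γδ} = δ^α_γ δ^β_δ + c · ε^{αβ} ε_{γδ}` (with `c = a^{±1}`). -/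
def Rm (q r : ℝ) (c : ℂ) (α β γ δ : Fin 2) : ℂ :=
  (if α = γ then 1 else 0) * (if β = δ then 1 else 0) + c * epsUp q r α β * epsLo q r γ δ

/-- The conjugate `σ̄_±^{α̇β} = a^{±1/2} Σ ε^{α̇λ̇} ε_{ρκ} R^{∓σκ}_{μν} ε^{μλ} ε^{νβ} σ_{σρ̇}`
of a 2×2 matrix `σ`; `s = true` is the `+` sign, `s = false` the `−` sign. -/
def sbar (q r a : ℝ) (s : Bool) (σ : Matrix (Fin 2) (Fin 2) ℂ) (ad b : Fin 2) : ℂ :=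
  (if s then (Real.sqrt a : ℂ) else ((Real.sqrt a : ℂ))⁻¹) *
    ∑ l, ∑ sg, ∑ rh, ∑ ka, ∑ mu, ∑ nu,
      epsUpD q r ad l * epsLo q r rh ka * Rm q r (if s then ((a : ℂ))⁻¹ else (a : ℂ)) sg ka mu nu *
        epsUp q r mu l * epsUp q r nu b * σ sg rh

/-- The quantum Pauli matrices `σ^0, σ^1, σ^2, σ^3`. -/
def pauli : Fin 4 → Matrix (Fin 2) (Fin 2) ℂ :=
  ![!![1, 0; 0, 1], !![0, 1; 1, 0], !![0, -Complex.I; Complex.I, 0], !![1, 0; 0, -1]]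

/-- The metric pairing `G_±^{IJ} = (1/Q) Σ ε^{αν} σ^I_{αβ̇} σ̄_±^{Jβ̇γ} ε_{γν}`. -/
def Gpair (q r a : ℝ) (s : Bool) (σI σJ : Matrix (Fin 2) (Fin 2) ℂ) : ℂ :=
  (1 / (Qval q r : ℂ)) * ∑ al, ∑ nu, ∑ be, ∑ ga,
    epsUp q r al nu * σI al be * sbar q r a s σJ be ga * epsLo q r ga nu

/-- The quantum Minkowski metric `G_±^{IJ}` as a 4×4 matrix. -/
def GupM (q r a : ℝ) (s : Bool) : Matrix (Fin 4) (Fin 4) ℂ :=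
  fun I J => Gpair q r a s (pauli I) (pauli J)

/-- The inverse metric `G_{±IJ}`. -/
def GloM (q r a : ℝ) (s : Bool) : Matrix (Fin 4) (Fin 4) ℂ := (GupM q r a s)⁻¹

/-- The lowered conjugate Pauli matrices `σ̄_L^{α̇β} = Σ_N G_{+LN} σ̄_+^{Nα̇β}`. -/
def sbarL (q r a : ℝ) (L : Fin 4) (ad b : Fin 2) : ℂ :=
  ∑ N, GloM q r a true L N * sbar q r a true (pauli N) ad b

/-- The quantum Lorentz group generators
`Λ_L^K = (1/Q) Σ ε_{γ̇δ̇} σ̄_L^{δ̇α} M_α^σ σ^K_{σρ̇} M̄_β̇^{ρ̇} ε^{γ̇β̇}`. -/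
def Lor {A : Type*} [Ring A] [Algebra ℂ A] (q r a : ℝ)
    (M Mb : Fin 2 → Fin 2 → A) (L K : Fin 4) : A :=
  ∑ ga, ∑ de, ∑ al, ∑ sg, ∑ rh, ∑ be,
    ((1 / (Qval q r : ℂ)) * epsLoD q r ga de * sbarL q r a L de al * pauli K sg rh *
      epsUpD q r ga be) • (M al sg * Mb be rh)

/-- The Lorentz R-matrices
`𝓡^{±NM}_{LK} = (1/Q²) Σ R^{∓ακ}_{τσ} R^{∓μβ}_{κν} R^{±ρξ}_{δα} R^{±λγ}_{ξμ}
σ^{M β̇}_γ σ^{N λ̇}_ρ σ̄_{Lτ̇}^δ σ̄_{Kν̇}^σ`. -/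
def Rlor (q r a : ℝ) (s : Bool) (N M L K : Fin 4) : ℂ :=
  (1 / (Qval q r : ℂ) ^ 2) *
    ∑ al, ∑ be, ∑ ga, ∑ de, ∑ ka, ∑ l, ∑ mu, ∑ nu, ∑ xi, ∑ rh, ∑ sg, ∑ ta,
      Rm q r (if s then ((a : ℂ))⁻¹ else (a : ℂ)) al ka ta sg *
        Rm q r (if s then ((a : ℂ))⁻¹ else (a : ℂ)) mu be ka nu *
          Rm q r (if s then (a : ℂ) else ((a : ℂ))⁻¹) rh xi de al *
            Rm q r (if s then (a : ℂ) else ((a : ℂ))⁻¹) l ga xi mu *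
              (∑ p, epsUpD q r be p * pauli M ga p) *
                (∑ p, epsUpD q r l p * pauli N rh p) *
                  (∑ p, epsLoD q r ta p * sbarL q r a L p de) *
                    (∑ p, epsLoD q r nu p * sbarL q r a K p sg)

end

open scoped Matrix

lemma sq_ofReal_sqrt_one_sub_sq {r : ℝ} (hr : r ^ 2 < 1) :
    ((Real.sqrt (1 - r ^ 2) : ℝ) : ℂ) ^ 2 = 1 - (r : ℂ) ^ 2 := by
  exact_mod_cast congrArg ((↑) : ℝ → ℂ) (Real.sq_sqrt (by linarith : 0 ≤ 1 - r ^ 2))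

lemma epsLo_mul_epsUp {q r : ℝ} (hq : 0 < q) (hr : r ^ 2 < 1) : epsLo q r * epsUp q r = 1 := by
  have hd := sq_ofReal_sqrt_one_sub_sq hr
  have hd0 : ((Real.sqrt (1 - r ^ 2) : ℝ) : ℂ) ≠ 0 :=
    Complex.ofReal_ne_zero.mpr (Real.sqrt_pos.mpr (by linarith)).ne'
  have hq0 : ((Real.sqrt q : ℝ) : ℂ) ≠ 0 := Complex.ofReal_ne_zero.mpr (Real.sqrt_pos.mpr hq).ne'
  ext i j
  fin_cases i <;> fin_cases j <;>
    simp [epsLo, epsUp, Matrix.mul_apply, Fin.sum_univ_two] <;> field_simp <;>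
    first | ring1 | linear_combination -hd + (r : ℂ) ^ 2 * Complex.I_sq

lemma epsUpD_mul_transpose_epsUp {q r : ℝ} (hq : 0 < q) (hr : r ^ 2 < 1) :
    epsUpD q r * (epsUp q r)ᵀ = -1 := by
  have hd := sq_ofReal_sqrt_one_sub_sq hr
  have hd0 : ((Real.sqrt (1 - r ^ 2) : ℝ) : ℂ) ≠ 0 :=
    Complex.ofReal_ne_zero.mpr (Real.sqrt_pos.mpr (by linarith)).ne'
  have hq0 : ((Real.sqrt q : ℝ) : ℂ) ≠ 0 := Complex.ofReal_ne_zero.mpr (Real.sqrt_pos.mpr hq).ne'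
  ext i j
  fin_cases i <;> fin_cases j <;>
    simp [epsUpD, epsUp, Matrix.mul_apply, Fin.sum_univ_two] <;> field_simp <;>
    first | ring1 | linear_combination hd - (r : ℂ) ^ 2 * Complex.I_sq

/-- The sum defining `sbar`, in matrix form for arbitrary spinor metrics. -/
lemma conjugate_sum_eq (U L D σ : Matrix (Fin 2) (Fin 2) ℂ) (c : ℂ) (x b : Fin 2) :
    ∑ l, ∑ sg, ∑ rh, ∑ ka, ∑ mu, ∑ nu,
      D x l * L rh ka *
        ((if sg = mu then 1 else 0) * (if ka = nu then 1 else 0) + c * U sg ka * L mu nu) *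
        U mu l * U nu b * σ sg rh =
      (D * Uᵀ * (σ * (L * U)) + (c * (σ * (L * Uᵀ)).trace) • (D * Uᵀ * (L * U))) x b := by
  simp [Matrix.mul_apply, Fin.sum_univ_two, Matrix.trace]
  ring

lemma sbar_eq {q r : ℝ} (hq : 0 < q) (hr : r ^ 2 < 1) (a : ℝ) (s : Bool)
    (σ : Matrix (Fin 2) (Fin 2) ℂ) :
    Matrix.of (sbar q r a s σ) =
      -(if s then (Real.sqrt a : ℂ) else ((Real.sqrt a : ℂ))⁻¹) •
        (σ + ((if s then ((a : ℂ))⁻¹ else (a : ℂ)) *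
          (σ * (epsLo q r * (epsUp q r)ᵀ)).trace) • (1 : Matrix (Fin 2) (Fin 2) ℂ)) := by
  ext x b
  rw [Matrix.of_apply]
  unfold sbar Rm
  rw [conjugate_sum_eq, epsLo_mul_epsUp hq hr, epsUpD_mul_transpose_epsUp hq hr]
  simp only [Matrix.mul_one, Matrix.neg_mul, Matrix.one_mul, Matrix.add_apply, Matrix.neg_apply,
    Matrix.smul_apply, smul_eq_mul]
  ring

lemma Gpair_eq_trace (q r a : ℝ) (s : Bool) (σ τ : Matrix (Fin 2) (Fin 2) ℂ) :
    Gpair q r a s σ τ =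
      (1 / (Qval q r : ℂ)) *
        (σ * Matrix.of (sbar q r a s τ) *
          (epsLo q r * (epsUp q r)ᵀ)).trace := by
  simp only [Gpair, Matrix.mul_apply, Fin.sum_univ_two, Matrix.trace, Matrix.diag_apply,
    Matrix.of_apply, Matrix.transpose_apply]
  ring

/-- Fierz completeness relation for the Pauli matrices. -/
lemma sum_trace_mul_pauli (σ : Matrix (Fin 2) (Fin 2) ℂ) :
    ∑ I, (σ * pauli I).trace • pauli I = (2 : ℂ) • σ := by
  ext i j
  fin_cases i <;> fin_cases j <;>
    simp [Fin.sum_univ_four, pauli, Matrix.mul_apply, Fin.sum_univ_two, Matrix.trace] <;>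
    ring_nf <;> simp <;> ring

lemma transpose_epsLo_mul_epsUp_mul {q r : ℝ} (hq : 0 < q) (hr : r ^ 2 < 1) :
    (epsLo q r)ᵀ * epsUp q r * (epsLo q r * (epsUp q r)ᵀ) = 1 := by
  have h := epsLo_mul_epsUp hq hr
  have hUL := mul_eq_one_comm.mp h
  have ht : (epsLo q r)ᵀ * (epsUp q r)ᵀ = 1 := by
    rw [← Matrix.transpose_mul, hUL, Matrix.transpose_one]
  rw [Matrix.mul_assoc, ← Matrix.mul_assoc (epsUp q r), hUL, Matrix.one_mul, ht]

/-- The matrices `(Q/2) K⁻¹ σ_I` with `K = ε_{··} (ε^{··})ᵀ`, which turn out to be the lowered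
conjugate Pauli matrices for both signs. -/
noncomputable def loweredConjugate (q r : ℝ) (I : Fin 4) : Matrix (Fin 2) (Fin 2) ℂ :=
  ((Qval q r : ℂ) / 2) • ((epsLo q r)ᵀ * epsUp q r * pauli I)

lemma sum_trace_smul_loweredConjugate {q r : ℝ} (hq : 0 < q) (hr : r ^ 2 < 1)
    (σ : Matrix (Fin 2) (Fin 2) ℂ) :
    ∑ I, (σ * pauli I * (epsLo q r * (epsUp q r)ᵀ)).trace • loweredConjugate q r I =
      (Qval q r : ℂ) • σ := by
  have hI (I : Fin 4) :
      (σ * pauli I * (epsLo q r * (epsUp q r)ᵀ)).trace • loweredConjugate q r I =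
        ((Qval q r : ℂ) / 2) • ((epsLo q r)ᵀ * epsUp q r *
          ((epsLo q r * (epsUp q r)ᵀ * σ * pauli I).trace • pauli I)) := by
    rw [Matrix.trace_mul_comm, ← Matrix.mul_assoc, loweredConjugate, Matrix.mul_smul, smul_comm]
  simp_rw [hI]
  rw [← Finset.smul_sum, ← Matrix.mul_sum, sum_trace_mul_pauli, Matrix.mul_smul, smul_smul,
    ← Matrix.mul_assoc, transpose_epsLo_mul_epsUp_mul hq hr, Matrix.one_mul,
    div_mul_cancel₀ _ two_ne_zero]

lemma sum_Gpair_smul_loweredConjugate {q r : ℝ} (hq : 0 < q) (hr : r ^ 2 < 1)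
    (hQ : (Qval q r : ℂ) ≠ 0) (a : ℝ) (s : Bool) (σ : Matrix (Fin 2) (Fin 2) ℂ) :
    ∑ I, Gpair q r a s σ (pauli I) • loweredConjugate q r I = Matrix.of (sbar q r a s σ) := by
  have h1 := sum_trace_smul_loweredConjugate hq hr (1 : Matrix (Fin 2) (Fin 2) ℂ)
  have hσ := sum_trace_smul_loweredConjugate hq hr σ
  simp only [Matrix.one_mul] at h1
  simp_rw [Gpair_eq_trace, sbar_eq hq hr]
  set f : ℂ := if s then (Real.sqrt a : ℂ) else ((Real.sqrt a : ℂ))⁻¹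
  set c : ℂ := if s then ((a : ℂ))⁻¹ else (a : ℂ)
  set K := epsLo q r * (epsUp q r)ᵀ
  have hI (I : Fin 4) :
      ((1 / (Qval q r : ℂ)) *
        (σ * (-f • (pauli I + (c * (pauli I * K).trace) • 1)) * K).trace) •
          loweredConjugate q r I =
        (-f / (Qval q r : ℂ)) • ((σ * pauli I * K).trace • loweredConjugate q r I +
          (c * (σ * K).trace) • ((pauli I * K).trace • loweredConjugate q r I)) := by
    simp only [Matrix.mul_smul, Matrix.smul_mul, Matrix.trace_smul, Matrix.mul_add,
      Matrix.add_mul, Matrix.trace_add, Matrix.mul_one, smul_eq_mul]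
    module
  simp_rw [hI]
  rw [← Finset.smul_sum, Finset.sum_add_distrib, ← Finset.smul_sum, hσ, h1,
    smul_comm _ (Qval q r : ℂ), ← smul_add, smul_smul, div_mul_cancel₀ _ hQ]

lemma sum_GloM_mul_sbar {q r : ℝ} (hq : 0 < q) (hr : r ^ 2 < 1)
    (hQ : (Qval q r : ℂ) ≠ 0) (a : ℝ) (s : Bool) (hG : IsUnit (GupM q r a s).det)
    (I : Fin 4) (α β : Fin 2) :
    ∑ N, GloM q r a s I N * sbar q r a s (pauli N) α β = loweredConjugate q r I α β := by
  have h : GupM q r a s *ᵥ (fun N => loweredConjugate q r N α β) =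
      fun N => sbar q r a s (pauli N) α β := by
    ext J
    rw [← Matrix.of_apply (sbar q r a s (pauli J)),
      ← sum_Gpair_smul_loweredConjugate hq hr hQ a s (pauli J)]
    simp [Matrix.mulVec, dotProduct, GupM, Matrix.sum_apply]
  change (GloM q r a s *ᵥ fun N => sbar q r a s (pauli N) α β) I = _
  rw [← h, Matrix.mulVec_mulVec, GloM, Matrix.nonsing_inv_mul _ hG, Matrix.one_mulVec]

/-- the lowered conjugate Pauli matrices are independent of the sign
choice: `Σ_N G_{+IN} σ̄_+^{Nα̇β} = Σ_N G_{−IN} σ̄_−^{Nα̇β}`. -/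
theorem sbar_lowered_sign_independent (q r : ℝ) (hq : 0 < q) (hr : r ^ 2 < 1)
    (a : ℝ) (ha : 0 < a) (haQ : a + a⁻¹ = Qval q r)
    (hG : ∀ s, IsUnit (GupM q r a s).det) :
    ∀ (I : Fin 4) (α β : Fin 2),
      ∑ N, GloM q r a true I N * sbar q r a true (pauli N) α β =
        ∑ N, GloM q r a false I N * sbar q r a false (pauli N) α β := by
  have hQ : (Qval q r : ℂ) ≠ 0 := by
    rw [← haQ]
    exact Complex.ofReal_ne_zero.mpr (by positivity)
  intro I α β
  rw [sum_GloM_mul_sbar hq hr hQ a true (hG true), sum_GloM_mul_sbar hq hr hQ a false (hG false)]
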